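/- Let λ = a_1 ϖ_1 + a_2 ϖ_2 with a_1, a_2 nonnegative integers and a_2 = 0. Then T_{λ,2} ∩ ℤ = {1, 2, …, M_{λ,2}} if and only if (a_1,a_2) = (i,0) for some i ∈ {0,1,2}. (This is the combinatorial criterion, via the main theorem, for an initialized irreducible homogeneous vector bundle on G2/P_{α_2} with highest weight λ to be an ACM bundle.) -/

import Mathlib

noncomputable section

/-- The ambient space ℝ^3. -/
abbrev V : Type := Fin 3 → ℝ

/-- The standard inner product on ℝ^3. -/
def ip (x y : V) : ℝ := ∑ i, x i * y i

/-- The standard basis vectors ε_1, ε_2, ε_3 (indexed from 0). -/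
def eps (i : Fin 3) : V := fun j => if j = i then 1 else 0

/-- The G2 root system: ±(ε_i−ε_j) (i<j) and ±(2ε_i−ε_j−ε_k)
    with {i,j,k} = {1,2,3}. -/
def PhiG2 : Set V :=
  {α | (∃ i j : Fin 3, i < j ∧ (α = eps i - eps j ∨ α = eps j - eps i)) ∨
       (∃ i j k : Fin 3, i ≠ j ∧ i ≠ k ∧ j ≠ k ∧
          (α = (2 : ℝ) • eps i - eps j - eps k ∨
           α = -((2 : ℝ) • eps i - eps j - eps k)))}

/-- Simple roots α_1, α_2 of G2 (indexed from 0). -/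
def sroot : Fin 2 → V :=
  ![eps 1 - eps 2,
    eps 0 - (2 : ℝ) • eps 1 + eps 2]

/-- Positive roots of G2: elements of Φ_{G2} that are nonnegative
    combinations of the simple roots. -/
def PosG : Set V :=
  {α | α ∈ PhiG2 ∧ ∃ c : Fin 2 → ℝ, (∀ i, 0 ≤ c i) ∧ α = ∑ i, c i • sroot i}

/-- Fundamental weights ϖ_1, ϖ_2 of G2 (indexed from 0). -/
def wG : Fin 2 → V :=
  ![eps 0 - eps 2,
    (2 : ℝ) • eps 0 - eps 1 - eps 2]

/-- ρ = ϖ_1 + ϖ_2. -/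
def rhoG : V := ∑ i, wG i

/-- Φ⁺_k = {α ∈ Φ⁺ : (ϖ_k, α) ≠ 0}. -/
def PhiKG (k : Fin 2) : Set V := {α ∈ PosG | ip (wG k) α ≠ 0}

/-- λ = a_1 ϖ_1 + a_2 ϖ_2. -/
def lamG (a : Fin 2 → ℕ) : V := ∑ i, (a i : ℝ) • wG i

/-- T_{λ,k} = {(λ+ρ, α)/c_{α,k} : α ∈ Φ⁺_k}. -/
def TG (a : Fin 2 → ℕ) (k : Fin 2) : Set ℝ :=
  {r | ∃ α ∈ PhiKG k, r = ip (lamG a + rhoG) α / ip (wG k) α}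

/-- M_{λ,k} = max T_{λ,k} (the set is finite and nonempty, so max = sSup). -/
def MG (a : Fin 2 → ℕ) (k : Fin 2) : ℝ := sSup (TG a k)

/-- The condition T_{λ,k} ∩ ℤ = {1, 2, …, M_{λ,k}}. -/
def ACMG (a : Fin 2 → ℕ) (k : Fin 2) : Prop :=
  {n : ℤ | (n : ℝ) ∈ TG a k} = {n : ℤ | 1 ≤ n ∧ (n : ℝ) ≤ MG a k}

lemma ip_wG_one (α : V) : ip (wG 1) α = 2 * α 0 - α 1 - α 2 := by
  simp [ip, wG, eps, Fin.sum_univ_three]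
  ring

lemma ip_lamG_add_rhoG (a : Fin 2 → ℕ) (h : a 1 = 0) (α : V) :
    ip (lamG a + rhoG) α = (a 0 + 3) * α 0 - α 1 - (a 0 + 2) * α 2 := by
  simp [ip, lamG, rhoG, wG, eps, Fin.sum_univ_three, h]
  ring

/-- Membership in `PhiKG 1` from simple-root coordinates `c`, `d`. -/
lemma mem_PhiKG_one {α : V} (hα : α ∈ PhiG2) {c d : ℝ} (hc : 0 ≤ c) (hd : 0 < d)
    (h0 : α 0 = d) (h1 : α 1 = c - 2 * d) (h2 : α 2 = d - c) : α ∈ PhiKG 1 := by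
  refine ⟨⟨hα, ![c, d], ?_, ?_⟩, ?_⟩
  · intro i
    fin_cases i
    · exact hc
    · exact hd.le
  · funext i
    fin_cases i
    · simp [sroot, eps, h0]
    · simp [sroot, eps, h1]
      ring
    · simp [sroot, eps, h2]
      ring
  · rw [ip_wG_one, h0, h1, h2]
    intro h
    linarith

lemma apply_zero_nonneg_of_mem_PosG {α : V} (hα : α ∈ PosG) : 0 ≤ α 0 := by
  obtain ⟨-, c, hc, rfl⟩ := hα
  simpa [sroot, eps] using hc 1

/-- The five coordinate vectors of the roots in `PhiKG 1`. -/
lemma coords_of_mem_PhiKG_one {α : V} (hα : α ∈ PhiKG 1) :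
    (α 0 = 1 ∧ α 1 = -2 ∧ α 2 = 1) ∨ (α 0 = 1 ∧ α 1 = -1 ∧ α 2 = 0) ∨
    (α 0 = 1 ∧ α 1 = 0 ∧ α 2 = -1) ∨ (α 0 = 1 ∧ α 1 = 1 ∧ α 2 = -2) ∨
    (α 0 = 2 ∧ α 1 = -1 ∧ α 2 = -1) := by
  obtain ⟨hpos, hne⟩ := hα
  have h0 := apply_zero_nonneg_of_mem_PosG hpos
  rw [ip_wG_one] at hne
  rcases hpos.1 with ⟨i, j, hij, rfl | rfl⟩ | ⟨i, j, k, hij, hik, hjk, rfl | rfl⟩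
  · fin_cases i <;> fin_cases j <;> simp [eps] at hij h0 hne ⊢
  · fin_cases i <;> fin_cases j <;> simp [eps] at hij h0 hne ⊢ <;> revert h0 hne <;> norm_num
  · fin_cases i <;> fin_cases j <;> fin_cases k <;>
      simp [eps] at hij hik hjk h0 hne ⊢ <;> revert h0 hne <;> norm_num
  · fin_cases i <;> fin_cases j <;> fin_cases k <;>
      simp [eps] at hij hik hjk h0 hne ⊢ <;> revert h0 hne <;> norm_num

lemma mem_TG_one_iff (a : Fin 2 → ℕ) (h : a 1 = 0) (r : ℝ) :
    r ∈ TG a 1 ↔ r = 1 ∨ r = 1 + ((a 0 : ℝ) + 1) / 3 ∨ r = 1 + 2 * ((a 0 : ℝ) + 1) / 3 ∨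
      r = 1 + ((a 0 : ℝ) + 1) ∨ r = 1 + ((a 0 : ℝ) + 1) / 2 := by
  constructor
  · rintro ⟨α, hα, rfl⟩
    rw [ip_lamG_add_rhoG a h, ip_wG_one]
    rcases coords_of_mem_PhiKG_one hα with
      ⟨h0, h1, h2⟩ | ⟨h0, h1, h2⟩ | ⟨h0, h1, h2⟩ | ⟨h0, h1, h2⟩ | ⟨h0, h1, h2⟩ <;>
      rw [h0, h1, h2]
    · left; ring
    · right; left; ring
    · right; right; left; ring
    · right; right; right; left; ring
    · right; right; right; right; ring
  · rintro (rfl | rfl | rfl | rfl | rfl)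
    · refine ⟨-((2 : ℝ) • eps 1 - eps 0 - eps 2), mem_PhiKG_one (c := 0) (d := 1)
        (Or.inr ⟨1, 0, 2, by decide, by decide, by decide, Or.inr rfl⟩)
        (by norm_num) (by norm_num) ?_ ?_ ?_, ?_⟩
      iterate 3 (simp [eps])
      rw [ip_lamG_add_rhoG a h, ip_wG_one]
      simp [eps]
      ring
    · refine ⟨eps 0 - eps 1, mem_PhiKG_one (c := 1) (d := 1)
        (Or.inl ⟨0, 1, by decide, Or.inl rfl⟩)
        (by norm_num) (by norm_num) ?_ ?_ ?_, ?_⟩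
      iterate 3 (simp [eps] <;> norm_num)
      rw [ip_lamG_add_rhoG a h, ip_wG_one]
      simp [eps]
      ring
    · refine ⟨eps 0 - eps 2, mem_PhiKG_one (c := 2) (d := 1)
        (Or.inl ⟨0, 2, by decide, Or.inl rfl⟩)
        (by norm_num) (by norm_num) ?_ ?_ ?_, ?_⟩
      iterate 3 (simp [eps] <;> norm_num)
      rw [ip_lamG_add_rhoG a h, ip_wG_one]
      simp [eps]
      ring
    · refine ⟨-((2 : ℝ) • eps 2 - eps 0 - eps 1), mem_PhiKG_one (c := 3) (d := 1)
        (Or.inr ⟨2, 0, 1, by decide, by decide, by decide, Or.inr rfl⟩)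
        (by norm_num) (by norm_num) ?_ ?_ ?_, ?_⟩
      iterate 3 (simp [eps] <;> norm_num)
      rw [ip_lamG_add_rhoG a h, ip_wG_one]
      simp [eps]
      ring
    · refine ⟨(2 : ℝ) • eps 0 - eps 1 - eps 2, mem_PhiKG_one (c := 3) (d := 2)
        (Or.inr ⟨0, 1, 2, by decide, by decide, by decide, Or.inl rfl⟩)
        (by norm_num) (by norm_num) ?_ ?_ ?_, ?_⟩
      iterate 3 (simp [eps] <;> norm_num)
      rw [ip_lamG_add_rhoG a h, ip_wG_one]
      simp [eps]
      ring

lemma MG_one_eq (a : Fin 2 → ℕ) (h : a 1 = 0) : MG a 1 = a 0 + 2 := by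
  have ha : (0 : ℝ) ≤ a 0 := Nat.cast_nonneg _
  refine IsGreatest.csSup_eq ⟨?_, ?_⟩
  · rw [mem_TG_one_iff a h]
    right; right; right; left; ring
  · intro r hr
    rw [mem_TG_one_iff a h] at hr
    rcases hr with rfl | rfl | rfl | rfl | rfl <;> linarith

/-- the ACM criterion on G2/P_{α_2} (k = 2 is indexed here
    by 1). -/
theorem stmt19 (a : Fin 2 → ℕ) (h : a 1 = 0) :
    ACMG a 1 ↔ ∃ i : ℕ, i ≤ 2 ∧ a 0 = i ∧ a 1 = 0 := by
  have key : ACMG a 1 ↔ ∀ n : ℤ,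
      (n = 1 ∨ 3 * n = a 0 + 4 ∨ 3 * n = 2 * a 0 + 5 ∨ n = a 0 + 2 ∨ 2 * n = a 0 + 3) ↔
        (1 ≤ n ∧ n ≤ a 0 + 2) := by
    rw [ACMG, Set.ext_iff]
    refine forall_congr' fun n => ?_
    simp only [Set.mem_ofPred_eq, mem_TG_one_iff a h, MG_one_eq a h]
    refine iff_congr (or_congr ?_ (or_congr ?_ (or_congr ?_ (or_congr ?_ ?_))))
      (and_congr Iff.rfl ?_)
    · norm_cast
    · rify
      constructor <;> intro _ <;> linarith
    · rify
      constructor <;> intro _ <;> linarith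
    · rify
      constructor <;> intro _ <;> linarith
    · rify
      constructor <;> intro _ <;> linarith
    · norm_cast
  rw [key]
  constructor
  · intro H
    have h2 := (H 2).2 (by omega)
    exact ⟨a 0, by omega, rfl, h⟩
  · rintro ⟨i, hi, hai, -⟩ n
    rw [hai]
    interval_cases i <;> omega
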